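/- arXiv:1110.5080 — 4 statements merged into one kernel-verified Lean document; each statement's English description precedes it below -/
import Mathlib

section
/- The relation ≤ on multisegments is a partial order; in particular it is antisymmetric: if M ≤ M' and M' ≤ M, then M = M'. (This follows because each elementary operation strictly increases the sum of the squares of the lengths of the segments.) -/
open scoped Classical

noncomputable section

/-- The segment `{a, a+1, ..., a+m-1}` as a finite set of reals. -/
def finsetSeg (a : ℝ) (m : ℕ) : Finset ℝ :=
  (Finset.range m).image (fun i => a + i)

/-- A segment is a nonempty subset of `ℝ` of the form `{a, a+1, ..., a+m-1}` with `m ≥ 1`. -/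
def IsSegment (S : Finset ℝ) : Prop :=
  ∃ (a : ℝ) (m : ℕ), 1 ≤ m ∧ S = finsetSeg a m

/-- A multisegment is a nonempty finite multiset of segments. -/
def IsMultisegment (M : Multiset (Finset ℝ)) : Prop :=
  M ≠ 0 ∧ ∀ S ∈ M, IsSegment S

/-- The beginning (smallest element) of a segment. -/
def beg (S : Finset ℝ) : ℝ := if h : S.Nonempty then S.min' h else 0

/-- The ending (largest element) of a segment. -/
def endg (S : Finset ℝ) : ℝ := if h : S.Nonempty then S.max' h else 0

/-- Two segments are linked if neither is included in the other and their union is a segment. -/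
def Linked (S₁ S₂ : Finset ℝ) : Prop :=
  ¬ S₁ ⊆ S₂ ∧ ¬ S₂ ⊆ S₁ ∧ IsSegment (S₁ ∪ S₂)

/-- `ElemOp M N` means that `N` is obtained from `M` by an elementary operation:
a pair of linked segments `S₁, S₂` of `M` is replaced by `S₁ ∪ S₂, S₁ ∩ S₂`,
the intersection being omitted when empty. -/
def ElemOp (M N : Multiset (Finset ℝ)) : Prop :=
  ∃ (S₁ S₂ : Finset ℝ) (rest : Multiset (Finset ℝ)),
    Linked S₁ S₂ ∧ M = S₁ ::ₘ S₂ ::ₘ rest ∧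
    N = (if S₁ ∩ S₂ = ∅ then (S₁ ∪ S₂) ::ₘ rest
         else (S₁ ∪ S₂) ::ₘ (S₁ ∩ S₂) ::ₘ rest)

/-- `msLE M M'` (i.e. `M ≤ M'`) : `M` is obtained from `M'` by a finite (possibly empty)
sequence of elementary operations. -/
def msLE (M M' : Multiset (Finset ℝ)) : Prop :=
  Relation.ReflTransGen ElemOp M' M

/-- The support of a multisegment: the multiset union of its segments. -/
def suppM (M : Multiset (Finset ℝ)) : Multiset ℝ :=
  (M.map Finset.val).sum

/-- The maxlength `m(M)`: the maximal length of the segments of `M`. -/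
def maxLen (M : Multiset (Finset ℝ)) : ℕ :=
  (M.map Finset.card).sup

/-- The thickness `t(M)`: the number of segments of `M`, counted with multiplicity. -/
def thickness (M : Multiset (Finset ℝ)) : ℕ := Multiset.card M

def sqSumM (M : Multiset (Finset ℝ)) : ℕ := (M.map (fun S => S.card ^ 2)).sum

theorem sqSumM_lt {M N : Multiset (Finset ℝ)} (h : ElemOp M N) : sqSumM M < sqSumM N := by
  obtain ⟨S, T, rest, ⟨h1, h2, -⟩, rfl, rfl⟩ := h
  have e := Finset.card_union_add_card_inter S T
  have a : S.card < (S ∪ T).card := Finset.card_lt_card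
    ⟨Finset.subset_union_left, fun h => h2 (Finset.subset_union_right.trans h)⟩
  have b : T.card < (S ∪ T).card := Finset.card_lt_card
    ⟨Finset.subset_union_right, fun h => h1 (Finset.subset_union_left.trans h)⟩
  have key : S.card ^ 2 + T.card ^ 2 < (S ∪ T).card ^ 2 + (S ∩ T).card ^ 2 := by
    zify at *
    nlinarith [mul_pos (sub_pos.2 a) (sub_pos.2 b)]
  split_ifs with hi
  · rw [hi] at key
    simp [sqSumM] at key ⊢
    omega
  · simp [sqSumM] at key ⊢
    omega

theorem msLE_eq_or_lt {M N : Multiset (Finset ℝ)} (h : msLE N M) :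
    M = N ∨ sqSumM M < sqSumM N := by
  unfold msLE at h
  induction h with
  | refl => exact Or.inl rfl
  | tail _ h ih =>
    have := sqSumM_lt h
    rcases ih with rfl | ih
    · exact Or.inr this
    · exact Or.inr (ih.trans this)

/-- The relation `≤` on multisegments is a partial order: it is reflexive, transitive and,
in particular, antisymmetric: if `M ≤ M'` and `M' ≤ M`, then `M = M'`. -/
theorem msLE_isPartialOrder :
    (∀ M : Multiset (Finset ℝ), IsMultisegment M → msLE M M) ∧
    (∀ M M' M'' : Multiset (Finset ℝ), IsMultisegment M → IsMultisegment M' →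
      IsMultisegment M'' → msLE M M' → msLE M' M'' → msLE M M'') ∧
    (∀ M M' : Multiset (Finset ℝ), IsMultisegment M → IsMultisegment M' →
      msLE M M' → msLE M' M → M = M') := by
  refine ⟨fun _ _ => Relation.ReflTransGen.refl, fun _ _ _ _ _ _ h h' => h'.trans h, ?_⟩
  intro M M' _ _ h h'
  rcases msLE_eq_or_lt h with e | l
  · exact e.symm
  · rcases msLE_eq_or_lt h' with e | l'
    · exact e
    · exact absurd (l.trans l') (lt_irrefl _)
end
end

section
/- The multiset of beginnings is increasing for the order on multisegments: if M ≤ M', then B(M) is contained in B(M') as multisets. -/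
open scoped Classical

noncomputable section

theorem mem_fs (a : ℝ) (m : ℕ) (x : ℝ) : x ∈ finsetSeg a m ↔ ∃ i : ℕ, i < m ∧ a + i = x := by
  simp only [finsetSeg, Finset.mem_image]
  simp

theorem beg_eq {S : Finset ℝ} {x : ℝ} (hx : x ∈ S) (h : ∀ y ∈ S, x ≤ y) : beg S = x := by
  have hS : S.Nonempty := ⟨x, hx⟩
  rw [beg, dif_pos hS]
  exact le_antisymm (Finset.min'_le _ _ hx) (Finset.le_min' _ _ _ h)

theorem self_mem_fs {a : ℝ} {m : ℕ} (hm : 1 ≤ m) : a ∈ finsetSeg a m :=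
  (mem_fs _ _ _).2 ⟨0, hm, by simp⟩

theorem le_of_mem_fs {a : ℝ} {m : ℕ} {x : ℝ} (h : x ∈ finsetSeg a m) : a ≤ x := by
  obtain ⟨i, _, rfl⟩ := (mem_fs _ _ _).1 h
  have : (0 : ℝ) ≤ i := Nat.cast_nonneg i
  linarith

theorem beg_fs {a : ℝ} {m : ℕ} (hm : 1 ≤ m) : beg (finsetSeg a m) = a :=
  beg_eq (self_mem_fs hm) fun _ h => le_of_mem_fs h

theorem beg_union {a b : ℝ} {m n : ℕ} (hm : 1 ≤ m) (hab : a ≤ b) :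
    beg (finsetSeg a m ∪ finsetSeg b n) = a := by
  apply beg_eq (Finset.mem_union_left _ (self_mem_fs hm))
  intro y hy
  rcases Finset.mem_union.1 hy with h | h
  · exact le_of_mem_fs h
  · exact hab.trans (le_of_mem_fs h)

theorem inter_fs {a b : ℝ} {m n : ℕ} (hab : a ≤ b)
    (hne : finsetSeg a m ∩ finsetSeg b n ≠ ∅) :
    ∃ k, 1 ≤ k ∧ finsetSeg a m ∩ finsetSeg b n = finsetSeg b k := by
  obtain ⟨x, hx⟩ := Finset.nonempty_iff_ne_empty.2 hne
  obtain ⟨h1, h2⟩ := Finset.mem_inter.1 hx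
  obtain ⟨i, hi, rfl⟩ := (mem_fs _ _ _).1 h1
  obtain ⟨j, hj, e⟩ := (mem_fs _ _ _).1 h2
  have hji : j ≤ i := by
    have : (j : ℝ) ≤ i := by linarith
    exact_mod_cast this
  obtain ⟨d, rfl⟩ := Nat.exists_eq_add_of_le hji
  have hb : b = a + d := by push_cast at e; linarith
  subst hb
  refine ⟨min (m - d) n, by omega, ?_⟩
  ext y
  rw [Finset.mem_inter, mem_fs, mem_fs, mem_fs]
  constructor
  · rintro ⟨⟨p, hp, rfl⟩, q, hq, e2⟩
    have : d + q = p := by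
      have : (d : ℝ) + q = p := by linarith
      exact_mod_cast this
    exact ⟨q, by omega, e2⟩
  · rintro ⟨q, hq, rfl⟩
    exact ⟨⟨d + q, by omega, by push_cast; ring⟩, q, by omega, rfl⟩

theorem step_aux {a b : ℝ} {m n : ℕ} (hm : 1 ≤ m) (hn : 1 ≤ n) (hab : a ≤ b)
    (rest : Multiset (Finset ℝ)) (hr : ∀ S ∈ rest, IsSegment S)
    (hU : IsSegment (finsetSeg a m ∪ finsetSeg b n)) (N : Multiset (Finset ℝ))
    (hN : N = (if finsetSeg a m ∩ finsetSeg b n = ∅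
         then (finsetSeg a m ∪ finsetSeg b n) ::ₘ rest
         else (finsetSeg a m ∪ finsetSeg b n) ::ₘ (finsetSeg a m ∩ finsetSeg b n) ::ₘ rest)) :
    (∀ S ∈ N, IsSegment S) ∧
      N.map beg ≤ (finsetSeg a m ::ₘ finsetSeg b n ::ₘ rest).map beg := by
  subst hN
  split_ifs with h
  · refine ⟨?_, ?_⟩
    · intro S hS
      rcases Multiset.mem_cons.1 hS with rfl | hS
      · exact hU
      · exact hr S hS
    · simp only [Multiset.map_cons, beg_union hm hab, beg_fs hm]
      exact Multiset.cons_le_cons _ (Multiset.le_cons_self _ _)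
  · obtain ⟨k, hk, e⟩ := inter_fs hab h
    refine ⟨?_, ?_⟩
    · intro S hS
      rcases Multiset.mem_cons.1 hS with rfl | hS
      · exact hU
      rcases Multiset.mem_cons.1 hS with rfl | hS
      · exact ⟨b, k, hk, e⟩
      · exact hr S hS
    · simp only [Multiset.map_cons, beg_union hm hab, beg_fs hm, e, beg_fs hn, beg_fs hk, le_refl]

theorem step {M N : Multiset (Finset ℝ)} (hM : ∀ S ∈ M, IsSegment S) (h : ElemOp M N) :
    (∀ S ∈ N, IsSegment S) ∧ N.map beg ≤ M.map beg := by
  obtain ⟨S, T, rest, ⟨_, _, hU⟩, rfl, hN⟩ := h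
  obtain ⟨a, m, hm, rfl⟩ := hM S (by simp)
  obtain ⟨b, n, hn, rfl⟩ := hM T (by simp)
  have hr : ∀ S ∈ rest, IsSegment S := fun S hS => hM S (by simp [hS])
  rcases le_total a b with hab | hab
  · exact step_aux hm hn hab rest hr hU N hN
  · rw [Multiset.cons_swap]
    rw [Finset.union_comm] at hU
    rw [Finset.union_comm, Finset.inter_comm] at hN
    exact step_aux hn hm hab rest hr hU N hN

/-- The multiset of beginnings is increasing for the order on multisegments:
if `M ≤ M'` then `B(M)` is contained in `B(M')` as multisets. -/
theorem beginnings_monotone_of_msLE (M M' : Multiset (Finset ℝ))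
    (hM : IsMultisegment M) (hM' : IsMultisegment M')
    (h : msLE M M') : M.map beg ≤ M'.map beg := by
  have key : (∀ S ∈ M, IsSegment S) ∧ M.map beg ≤ M'.map beg := by
    unfold msLE at h
    clear hM
    induction h with
    | refl => exact ⟨hM'.2, le_refl _⟩
    | tail _ h2 ih =>
      obtain ⟨h3, h4⟩ := step ih.1 h2
      exact ⟨h3, h4.trans ih.2⟩
  exact key.2
end
end

section
/- Elementary operations cannot shorten the segment through a point of multiplicity one: let M ≤ M' be multisegments and let e be an element of supp(M') having multiplicity one in supp(M'). Then e has multiplicity one in supp(M), and the unique segment of M containing e is at least as long as the unique segment of M' containing e. -/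
open scoped Classical

noncomputable section

theorem count_suppM_cons (e : ℝ) (S : Finset ℝ) (N : Multiset (Finset ℝ)) :
    Multiset.count e (suppM (S ::ₘ N)) =
      (if e ∈ S then 1 else 0) + Multiset.count e (suppM N) := by
  simp only [suppM, Multiset.map_cons, Multiset.sum_cons, Multiset.count_add]
  congr 1
  rw [Multiset.count_eq_of_nodup S.nodup]
  simp

theorem count_suppM_elemOp {M N : Multiset (Finset ℝ)} (h : ElemOp M N) (e : ℝ) :
    Multiset.count e (suppM N) = Multiset.count e (suppM M) := by
  obtain ⟨S₁, S₂, rest, -, rfl, rfl⟩ := h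
  split_ifs with hi
  · have : ¬ (e ∈ S₁ ∧ e ∈ S₂) := by
      rw [← Finset.mem_inter, hi]; simp
    simp only [count_suppM_cons, Finset.mem_union]
    by_cases h1 : e ∈ S₁ <;> by_cases h2 : e ∈ S₂ <;> simp_all
  · simp only [count_suppM_cons, Finset.mem_union, Finset.mem_inter]
    by_cases h1 : e ∈ S₁ <;> by_cases h2 : e ∈ S₂ <;> simp_all

theorem seg_unique {M : Multiset (Finset ℝ)} {e : ℝ}
    (he : Multiset.count e (suppM M) = 1) {S T : Finset ℝ} (hS : S ∈ M) (hT : T ∈ M)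
    (heS : e ∈ S) (heT : e ∈ T) : S = T := by
  by_contra hne
  obtain ⟨R, rfl⟩ := Multiset.exists_cons_of_mem hS
  rcases Multiset.mem_cons.1 hT with h | h
  · exact hne h.symm
  · obtain ⟨Q, rfl⟩ := Multiset.exists_cons_of_mem h
    simp only [count_suppM_cons, heS, heT, if_true] at he
    omega

/-- Elementary operations cannot shorten the segment through a point of multiplicity one:
if `M ≤ M'` and `e` has multiplicity one in `supp(M')`, then `e` has multiplicity one in
`supp(M)`, and the unique segment of `M` containing `e` is at least as long as the unique
segment of `M'` containing `e`. -/
theorem segment_through_mult_one_point (M M' : Multiset (Finset ℝ))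
    (hM : IsMultisegment M) (hM' : IsMultisegment M')
    (h : msLE M M') (e : ℝ)
    (he : Multiset.count e (suppM M') = 1) :
    Multiset.count e (suppM M) = 1 ∧
      ∀ S ∈ M, ∀ S' ∈ M', e ∈ S → e ∈ S' → S'.card ≤ S.card := by
  clear hM hM'
  induction h with
  | refl =>
    exact ⟨he, fun S hS S' hS' h1 h2 => (seg_unique he hS hS' h1 h2) ▸ le_rfl⟩
  | @tail A B _ hop ih =>
    obtain ⟨hc, ih⟩ := ih
    refine ⟨(count_suppM_elemOp hop e).trans hc, ?_⟩
    obtain ⟨S₁, S₂, rest, -, rfl, rfl⟩ := hop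
    intro S hS S' hS' h1 h2
    have key : S = S₁ ∪ S₂ ∨ S = S₁ ∩ S₂ ∨ S ∈ rest := by
      split_ifs at hS with hi
      · rcases Multiset.mem_cons.1 hS with h | h
        · exact Or.inl h
        · exact Or.inr (Or.inr h)
      · simpa using hS
    rcases key with rfl | rfl | h
    · rcases Finset.mem_union.1 h1 with h | h
      · exact (ih S₁ (by simp) S' hS' h h2).trans (Finset.card_le_card Finset.subset_union_left)
      · exact (ih S₂ (by simp) S' hS' h h2).trans (Finset.card_le_card Finset.subset_union_right)
    · obtain ⟨h3, h4⟩ := Finset.mem_inter.1 h1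
      simp only [count_suppM_cons, h3, h4, if_true] at hc
      omega
    · exact ih S (by simp [h]) S' hS' h1 h2
end
end

section
/- The determinantal identity [F] for Speh characters: let R be a commutative ring and let z : ℝ × ℤ → R be a function such that z(x, 0) = 1 for all x ∈ ℝ and z(x, m) = 0 for all x ∈ ℝ and all integers m < 0. For integers l ≥ 0, k ≥ 0 and s ∈ ℝ, define F_s(l, k) := Σ_{w ∈ S_k} sgn(w) · Π_{i=1}^{k} z(i − (k+l)/2 + s, w(i) + l − i), where S_k is the symmetric group on {1, ..., k} (so F_s(l, 0) = 1, and terms with some w(i) + l − i < 0 vanish). Then for all integers l ≥ 1 and k ≥ 1 one has F_{−1/2}(l, k) · F_{1/2}(l, k) = F_0(l, k−1) · F_0(l, k+1) + F_0(l−1, k) · F_0(l+1, k). -/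
noncomputable section

/-- The character polynomial `F_s(l, k)` of a Speh representation:
`F_s(l, k) = ∑_{w ∈ S_k} sgn(w) ∏_{i=1}^{k} z(i - (k+l)/2 + s, w(i) + l - i)`,
where `z : ℝ → ℤ → R` models the classification elements `Z(ρ, a, m)`. -/
def FSpeh {R : Type*} [CommRing R] (z : ℝ → ℤ → R) (s : ℝ) (l k : ℕ) : R :=
  ∑ w : Equiv.Perm (Fin k),
    ((Equiv.Perm.sign w : ℤ) : R) *
      ∏ i : Fin k,
        z ((((i : ℕ) : ℝ) + 1) - ((k : ℝ) + (l : ℝ)) / 2 + s)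
          ((((w i : ℕ) : ℤ) + 1) + (l : ℤ) - (((i : ℕ) : ℤ) + 1))

open Matrix in
theorem dodg_aux {R : Type*} [CommRing R] {n : Type*} [Fintype n] [DecidableEq n]
    (M : Matrix (Fin 2 ⊕ n) (Fin 2 ⊕ n) R) :
    M.det * M.adjugate.toBlocks₁₁.det = M.det * (M.det * M.toBlocks₂₂.det) := by
  have h1 : M * fromBlocks M.adjugate.toBlocks₁₁ 0 M.adjugate.toBlocks₂₁ 1 =
      fromBlocks (M.det • (1 : Matrix (Fin 2) (Fin 2) R)) M.toBlocks₁₂ 0 M.toBlocks₂₂ := by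
    have h := M.mul_adjugate
    rw [← fromBlocks_toBlocks M.adjugate] at h
    conv at h => lhs; lhs; rw [← fromBlocks_toBlocks M]
    rw [fromBlocks_multiply, ← fromBlocks_one, fromBlocks_smul, fromBlocks_inj] at h
    conv => lhs; lhs; rw [← fromBlocks_toBlocks M]
    rw [fromBlocks_multiply, h.1, h.2.2.1]
    simp
  have h2 := congrArg Matrix.det h1
  rw [det_mul, det_fromBlocks_zero₁₂, det_fromBlocks_zero₂₁, det_smul] at h2
  simp only [det_one, mul_one, Fintype.card_fin] at h2
  rw [h2]; ring

open Matrix in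
theorem dodg_block {R : Type*} [CommRing R] {n : Type*} [Fintype n] [DecidableEq n]
    (M : Matrix (Fin 2 ⊕ n) (Fin 2 ⊕ n) R) :
    M.adjugate.toBlocks₁₁.det = M.det * M.toBlocks₂₂.det := by
  have h := mul_left_cancel₀ (det_mvPolynomialX_ne_zero (Fin 2 ⊕ n) ℤ)
    (dodg_aux (mvPolynomialX (Fin 2 ⊕ n) (Fin 2 ⊕ n) ℤ))
  let f : MvPolynomial ((Fin 2 ⊕ n) × (Fin 2 ⊕ n)) ℤ →+* R :=
    MvPolynomial.eval₂Hom (Int.castRingHom R) (fun p => M p.1 p.2)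
  have hf : f.mapMatrix (mvPolynomialX (Fin 2 ⊕ n) (Fin 2 ⊕ n) ℤ) = M := by
    ext i j
    simp [f, mvPolynomialX]
  have h2 := congrArg f h
  rw [map_mul, f.map_det, f.map_det, f.map_det, hf] at h2
  have h3 : f.mapMatrix (mvPolynomialX (Fin 2 ⊕ n) (Fin 2 ⊕ n) ℤ).adjugate = M.adjugate := by
    rw [f.map_adjugate, hf]
  rw [← h3]
  refine Eq.trans h2 ?_
  conv_rhs => rw [← hf]
  rw [hf]
  congr 2
  conv_rhs => rw [← hf]
  rfl

def dodgFun (m : ℕ) : Fin 2 ⊕ Fin m → Fin (m + 2) :=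
  Sum.elim ![0, Fin.last (m + 1)] (fun i => i.succ.castSucc)

theorem dodgFun_bij (m : ℕ) : Function.Bijective (dodgFun m) := by
  rw [Fintype.bijective_iff_injective_and_card]
  refine ⟨?_, by simp [add_comm]⟩
  rintro (a | a) (b | b) h
  · fin_cases a <;> fin_cases b <;> simp [dodgFun, Fin.ext_iff] at h ⊢
  · have := b.2
    fin_cases a <;> simp [dodgFun, Fin.ext_iff] at h
    omega
  · have := a.2
    fin_cases b <;> simp [dodgFun, Fin.ext_iff] at h
    omega
  · simp [dodgFun, Fin.ext_iff] at h
    simp [Fin.ext_iff, h]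

open Matrix in
theorem dodg {R : Type*} [CommRing R] (m : ℕ) (M : Matrix (Fin (m + 2)) (Fin (m + 2)) R) :
    (M.submatrix Fin.castSucc Fin.castSucc).det * (M.submatrix Fin.succ Fin.succ).det =
      (M.submatrix (fun i : Fin m => i.succ.castSucc) (fun i : Fin m => i.succ.castSucc)).det
        * M.det +
      (M.submatrix Fin.succ Fin.castSucc).det * (M.submatrix Fin.castSucc Fin.succ).det := by
  let e := Equiv.ofBijective _ (dodgFun_bij m)
  have h := dodg_block (M.submatrix e e)
  rw [det_submatrix_equiv_self, adjugate_submatrix_equiv_self, det_fin_two] at h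
  have e0 : e (Sum.inl 0) = 0 := rfl
  have e1 : e (Sum.inl 1) = Fin.last (m + 1) := rfl
  have e2 : (M.submatrix e e).toBlocks₂₂ =
    M.submatrix (fun i : Fin m => i.succ.castSucc) (fun i : Fin m => i.succ.castSucc) := rfl
  rw [e2] at h
  simp only [toBlocks₁₁, of_apply, submatrix_apply, e0, e1,
    adjugate_fin_succ_eq_det_submatrix] at h
  have s0 : (0 : Fin (m + 2)).succAbove = Fin.succ := by ext; simp
  have s1 : (Fin.last (m + 1)).succAbove = Fin.castSucc := by ext; simp
  have s : ((-1 : R) ^ (m + 1)) * (-1) ^ (m + 1) = 1 := by rw [← mul_pow]; simp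
  simp only [s0, s1, Fin.val_zero, Fin.val_last, add_zero, zero_add, pow_zero, pow_add _ (m+1) (m+1), s] at h
  linear_combination h + (M.submatrix Fin.succ Fin.castSucc).det *
    (M.submatrix Fin.castSucc Fin.succ).det * s

theorem FSpeh_eq_det {R : Type*} [CommRing R] (z : ℝ → ℤ → R) (s : ℝ) (l k : ℕ) :
    FSpeh z s l k = (Matrix.of fun i j : Fin k =>
      z ((((i : ℕ) : ℝ) + 1) - ((k : ℝ) + (l : ℝ)) / 2 + s)
          ((((j : ℕ) : ℤ) + 1) + (l : ℤ) - (((i : ℕ) : ℤ) + 1))).det := by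
  rw [← Matrix.det_transpose, Matrix.det_apply']
  rfl

/-- The determinantal identity [F] for Speh characters:
`F_{-1/2}(l,k) F_{1/2}(l,k) = F_0(l,k-1) F_0(l,k+1) + F_0(l-1,k) F_0(l+1,k)`. -/
theorem FSpeh_determinantal_identity {R : Type*} [CommRing R]
    (z : ℝ → ℤ → R)
    (hz0 : ∀ x : ℝ, z x 0 = 1)
    (hzneg : ∀ (x : ℝ) (m : ℤ), m < 0 → z x m = 0)
    (l k : ℕ) (hl : 1 ≤ l) (hk : 1 ≤ k) :
    FSpeh z (-(1 / 2)) l k * FSpeh z (1 / 2) l k =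
      FSpeh z 0 l (k - 1) * FSpeh z 0 l (k + 1) +
        FSpeh z 0 (l - 1) k * FSpeh z 0 (l + 1) k := by
  obtain ⟨m, rfl⟩ : ∃ m, k = m + 1 := ⟨k - 1, by omega⟩
  obtain ⟨l, rfl⟩ : ∃ n, l = n + 1 := ⟨l - 1, by omega⟩
  simp only [FSpeh_eq_det, Nat.add_sub_cancel]
  have h := dodg m (Matrix.of fun i j : Fin (m + 2) =>
      z ((((i : ℕ) : ℝ) + 1) - (((m + 1 + 1 : ℕ) : ℝ) + ((l + 1 : ℕ) : ℝ)) / 2 + 0)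
          ((((j : ℕ) : ℤ) + 1) + ((l + 1 : ℕ) : ℤ) - (((i : ℕ) : ℤ) + 1)))
  convert h using 3
  all_goals first
    | rfl
    | (congr 1
       ext i j
       simp only [Matrix.of_apply, Matrix.submatrix_apply, Fin.val_succ, Fin.val_castSucc]
       congr 1 <;> push_cast <;> ring)
end
end
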